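/- arXiv:2509.01894 — 9 statements merged into one kernel-verified Lean document; each statement's English description precedes it below -/
import Mathlib

section
/- Recursive path-sum identity for two hidden states (Proposition 2 of the paper): for every integer k ≥ 2, the sum over all state traces s : {0,…,k−1} → {G,B} of Pr(s) · ( Γ_s^{s(0)} · (∏_{j=1}^{k−2} Q^{s(j)}) · Γ_e^{s(k−1)} ) equals the 1×1 matrix [π_G, π_B] · 𝚪_s · (T_ζ 𝐐)^{k−2} · T_ζ · 𝚪ₑᶜ. (Both sides are real numbers; no positivity or stochasticity assumptions on p, r or on the matrices are needed.) -/
open Matrix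

/-- The 2×2 Gilbert–Elliott state-transition matrix `T₁`. -/
noncomputable def T1 (p r : ℝ) : Matrix (Fin 2) (Fin 2) ℝ := !![1 - p, p; r, 1 - r]

/-- The `2ζ×2ζ` block state-transition matrix `T_ζ`. -/
noncomputable def Tblock (p r : ℝ) (ζ : ℕ) :
    Matrix (Fin 2 × Fin ζ) (Fin 2 × Fin ζ) ℝ :=
  Matrix.of fun x y => T1 p r x.1 y.1 * (if x.2 = y.2 then 1 else 0)

/-- The `2×2ζ` block-diagonal matrix `𝚪_s` with diagonal blocks `Γ_s^G, Γ_s^B`. -/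
noncomputable def GammaSblock {ζ : ℕ} (Γs : Fin 2 → Matrix (Fin 1) (Fin ζ) ℝ) :
    Matrix (Fin 2) (Fin 2 × Fin ζ) ℝ :=
  Matrix.of fun a y => if a = y.1 then Γs a 0 y.2 else 0

/-- The `2ζ×2ζ` block-diagonal matrix `𝐐` with diagonal blocks `Q^G, Q^B`. -/
noncomputable def Qblock {ζ : ℕ} (Q : Fin 2 → Matrix (Fin ζ) (Fin ζ) ℝ) :
    Matrix (Fin 2 × Fin ζ) (Fin 2 × Fin ζ) ℝ :=
  Matrix.of fun x y => if x.1 = y.1 then Q x.1 x.2 y.2 else 0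

/-- The `2ζ×1` stacked column vector `𝚪ₑᶜ = [Γ_e^G; Γ_e^B]`. -/
noncomputable def GammaEcol {ζ : ℕ} (Γe : Fin 2 → Matrix (Fin ζ) (Fin 1) ℝ) :
    Matrix (Fin 2 × Fin ζ) (Fin 1) ℝ :=
  Matrix.of fun x _ => Γe x.1 x.2 0

theorem Tblock_mul_apply {ζ : ℕ} {κ : Type*} (p r : ℝ) (M : Matrix (Fin 2 × Fin ζ) κ ℝ)
    (a : Fin 2) (i : Fin ζ) (c : κ) :
    (Tblock p r ζ * M) (a, i) c = ∑ b, T1 p r a b * M (b, i) c := by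
  simp [Matrix.mul_apply, Tblock, Fintype.sum_prod_type]

theorem Qblock_mul_apply {ζ : ℕ} {κ : Type*} (Q : Fin 2 → Matrix (Fin ζ) (Fin ζ) ℝ)
    (M : Matrix (Fin 2 × Fin ζ) κ ℝ) (a : Fin 2) (i : Fin ζ) (c : κ) :
    (Qblock Q * M) (a, i) c = ∑ l, Q a i l * M (a, l) c := by
  simp [Matrix.mul_apply, Qblock, Fintype.sum_prod_type, ite_mul, Finset.sum_ite_irrel]

theorem mul_GammaSblock_apply {ζ : ℕ} {κ : Type*} (M : Matrix κ (Fin 2) ℝ)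
    (Γs : Fin 2 → Matrix (Fin 1) (Fin ζ) ℝ) (c : κ) (a : Fin 2) (i : Fin ζ) :
    (M * GammaSblock Γs) c (a, i) = M c a * Γs a 0 i := by
  simp [Matrix.mul_apply, GammaSblock]

/-- A sum over traces of length `n + 1` is a sum over the first state and the remaining trace. -/
theorem sum_traces_succ {M σ : Type*} [AddCommMonoid M] [Fintype σ] (n : ℕ)
    (f : (Fin (n + 1) → σ) → M) :
    ∑ s, f s = ∑ a, ∑ t : Fin n → σ, f (Fin.cons a t) := by
  rw [← (Fin.consEquiv fun _ : Fin (n + 1) => σ).sum_comp, Fintype.sum_prod_type]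
  rfl

/-- The weighted sum over all continuations of a trace that is currently in state `a`. -/
theorem sum_continuations {ζ : ℕ} (p r : ℝ) (Q : Fin 2 → Matrix (Fin ζ) (Fin ζ) ℝ)
    (Γe : Fin 2 → Matrix (Fin ζ) (Fin 1) ℝ) (n : ℕ) (a : Fin 2) :
    (∑ s : Fin (n + 1) → Fin 2,
      (∏ j : Fin (n + 1), T1 p r ((Fin.cons a s : Fin (n + 2) → Fin 2) j.castSucc) (s j)) •
        ((List.ofFn fun j : Fin n => Q (s j.castSucc)).prod * Γe (s (Fin.last n)))) =
      Matrix.of fun i c =>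
        ((Tblock p r ζ * Qblock Q) ^ n * Tblock p r ζ * GammaEcol Γe) (a, i) c := by
  induction n generalizing a with
  | zero =>
    ext i c
    obtain rfl := Subsingleton.elim c 0
    rw [sum_traces_succ]
    simp [Tblock_mul_apply, GammaEcol, Matrix.sum_apply]
  | succ n ih =>
    have step (b : Fin 2) : (∑ t : Fin (n + 1) → Fin 2,
        (∏ j : Fin (n + 2), T1 p r
          ((Fin.cons a (Fin.cons b t : Fin (n + 2) → Fin 2) : Fin (n + 3) → Fin 2) j.castSucc)
          ((Fin.cons b t : Fin (n + 2) → Fin 2) j)) •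
        ((List.ofFn fun j : Fin (n + 1) =>
            Q ((Fin.cons b t : Fin (n + 2) → Fin 2) j.castSucc)).prod *
          Γe ((Fin.cons b t : Fin (n + 2) → Fin 2) (Fin.last (n + 1))))) =
        T1 p r a b • (Q b * Matrix.of fun i c =>
          ((Tblock p r ζ * Qblock Q) ^ n * Tblock p r ζ * GammaEcol Γe) (b, i) c) := by
      rw [← ih b, Matrix.mul_sum, Finset.smul_sum]
      refine Finset.sum_congr rfl fun t _ => ?_
      rw [Fin.prod_univ_succ, List.ofFn_succ, List.prod_cons, ← Fin.succ_last]
      simp only [Fin.castSucc_zero, ← Fin.succ_castSucc, Fin.cons_zero, Fin.cons_succ,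
        Matrix.mul_smul, smul_smul, Matrix.mul_assoc]
    rw [sum_traces_succ, Finset.sum_congr rfl fun b _ => step b]
    ext i c
    simp only [pow_succ', Matrix.mul_assoc, Matrix.of_apply, Tblock_mul_apply, Qblock_mul_apply,
      Matrix.sum_apply, Matrix.smul_apply, smul_eq_mul, Matrix.mul_apply (M := Q _)]

/-- **Proposition 2** (recursive path-sum identity for two hidden states): for every `k ≥ 2`,
the sum over all state traces `s : Fin k → {G,B}` of
`Pr(s) · (Γ_s^{s(0)} · ∏_{j=1}^{k-2} Q^{s(j)} · Γ_e^{s(k-1)})` equals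
`[π_G, π_B] · 𝚪_s · (T_ζ 𝐐)^{k-2} · T_ζ · 𝚪ₑᶜ`. -/
theorem path_sum_two_states (ζ : ℕ) (hζ : 1 ≤ ζ) (p r πG πB : ℝ)
    (Γs : Fin 2 → Matrix (Fin 1) (Fin ζ) ℝ)
    (Q : Fin 2 → Matrix (Fin ζ) (Fin ζ) ℝ)
    (Γe : Fin 2 → Matrix (Fin ζ) (Fin 1) ℝ)
    (k : ℕ) (hk : 2 ≤ k) :
    (∑ s : Fin k → Fin 2,
      (![πG, πB] (s ⟨0, by omega⟩) *
        ∏ j : Fin (k - 1),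
          T1 p r (s (Fin.castLE (by omega) j)) (s (Fin.cast (by omega) j.succ))) *
      ((Γs (s ⟨0, by omega⟩) *
          (List.ofFn fun j : Fin (k - 2) => Q (s (Fin.castLE (by omega) j.succ))).prod *
          Γe (s ⟨k - 1, by omega⟩)) 0 0)) =
    ((Matrix.of fun (_ : Fin 1) (a : Fin 2) => ![πG, πB] a) * GammaSblock Γs *
        (Tblock p r ζ * Qblock Q) ^ (k - 2) * Tblock p r ζ * GammaEcol Γe) 0 0 := by
  obtain ⟨n, rfl⟩ := Nat.exists_eq_add_of_le' hk
  have step (a : Fin 2) := congrArg (fun M => (![πG, πB] a • (Γs a * M)) 0 0)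
    (sum_continuations p r Q Γe n a)
  simp only [Matrix.mul_sum, Finset.smul_sum, Matrix.sum_apply] at step
  refine (sum_traces_succ (n + 1) _).trans ?_
  rw [Matrix.mul_assoc (_ * GammaSblock Γs), Matrix.mul_assoc (_ * GammaSblock Γs),
    Matrix.mul_apply, Fintype.sum_prod_type]
  refine Finset.sum_congr rfl fun a _ => Eq.trans (Finset.sum_congr rfl fun t _ => ?_)
    ((step a).trans ?_)
  · simp only [Matrix.mul_smul, Matrix.smul_apply, smul_eq_mul, ← mul_assoc, ← Matrix.mul_assoc]
    rfl
  · simp only [mul_GammaSblock_apply, Matrix.smul_apply, Matrix.mul_apply (M := Γs a),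
      smul_eq_mul, Finset.mul_sum, Matrix.of_apply, mul_assoc, Nat.add_sub_cancel]
end

section
/- Generalized path-sum identity for L hidden states (equation (44) of the paper, generalizing Proposition 2 to any hidden Markov channel with L ≥ 2 states): for every integer k ≥ 2, the sum over all state traces s : {0,…,k−1} → {1,…,L} of π_{s(0)} · (∏_{j=0}^{k−2} t(s(j), s(j+1))) · ( Γ_s^{s(0)} · (∏_{j=1}^{k−2} Q^{s(j)}) · Γ_e^{s(k−1)} ) equals the 1×1 matrix [π_1, …, π_L] · 𝚪_s · (𝐓 𝐐)^{k−2} · 𝐓 · 𝚪ₑᶜ. -/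
open Matrix

/-- The `Lζ×Lζ` block matrix `𝐓` whose `(a,b)` block is `t(a,b)·I_ζ`. -/
noncomputable def TblockL {L : ℕ} (t : Matrix (Fin L) (Fin L) ℝ) (ζ : ℕ) :
    Matrix (Fin L × Fin ζ) (Fin L × Fin ζ) ℝ :=
  Matrix.of fun x y => t x.1 y.1 * (if x.2 = y.2 then 1 else 0)

/-- The `L×Lζ` block-diagonal matrix `𝚪_s` with diagonal blocks `Γ_s^1, …, Γ_s^L`. -/
noncomputable def GammaSblockL {L ζ : ℕ} (Γs : Fin L → Matrix (Fin 1) (Fin ζ) ℝ) :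
    Matrix (Fin L) (Fin L × Fin ζ) ℝ :=
  Matrix.of fun a y => if a = y.1 then Γs a 0 y.2 else 0

/-- The `Lζ×Lζ` block-diagonal matrix `𝐐` with diagonal blocks `Q^1, …, Q^L`. -/
noncomputable def QblockL {L ζ : ℕ} (Q : Fin L → Matrix (Fin ζ) (Fin ζ) ℝ) :
    Matrix (Fin L × Fin ζ) (Fin L × Fin ζ) ℝ :=
  Matrix.of fun x y => if x.1 = y.1 then Q x.1 x.2 y.2 else 0

/-- The `Lζ×1` stacked column vector `𝚪ₑᶜ = [Γ_e^1; … ; Γ_e^L]`. -/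
noncomputable def GammaEcolL {L ζ : ℕ} (Γe : Fin L → Matrix (Fin ζ) (Fin 1) ℝ) :
    Matrix (Fin L × Fin ζ) (Fin 1) ℝ :=
  Matrix.of fun x _ => Γe x.1 x.2 0

theorem sum_fin_succ_pi {α M : Type*} [Fintype α] [AddCommMonoid M] {n : ℕ}
    (f : (Fin (n + 1) → α) → M) :
    ∑ s, f s = ∑ a, ∑ s : Fin n → α, f (Fin.cons a s) := by
  rw [← Fintype.sum_prod_type']
  exact (Fintype.sum_equiv (Fin.consEquiv fun _ => α) _ _ fun _ => rfl).symm

theorem TblockL_mul_apply {L ζ : ℕ} (t : Matrix (Fin L) (Fin L) ℝ)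
    (w : Matrix (Fin L × Fin ζ) (Fin 1) ℝ) (a : Fin L) (i : Fin ζ) :
    (TblockL t ζ * w) (a, i) 0 = ∑ b, t a b * w (b, i) 0 := by
  simp [TblockL, Matrix.mul_apply, Fintype.sum_prod_type]

theorem QblockL_mul_apply {L ζ : ℕ} (Q : Fin L → Matrix (Fin ζ) (Fin ζ) ℝ)
    (w : Matrix (Fin L × Fin ζ) (Fin 1) ℝ) (a : Fin L) (i : Fin ζ) :
    (QblockL Q * w) (a, i) 0 = ∑ j, Q a i j * w (a, j) 0 := by
  simp [QblockL, Matrix.mul_apply, Fintype.sum_prod_type, ite_mul, Finset.sum_ite_irrel]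

theorem GammaSblockL_mul_apply {L ζ : ℕ} (Γs : Fin L → Matrix (Fin 1) (Fin ζ) ℝ)
    (w : Matrix (Fin L × Fin ζ) (Fin 1) ℝ) (a : Fin L) :
    (GammaSblockL Γs * w) a 0 = ∑ i, Γs a 0 i * w (a, i) 0 := by
  simp [GammaSblockL, Matrix.mul_apply, Fintype.sum_prod_type, ite_mul, Finset.sum_ite_irrel]

/-- Entries of `(𝐓 𝐐)^n 𝐓 𝚪ₑᶜ` as sums over the traces that start in a given state. -/
theorem TQ_pow_mul_apply {L ζ : ℕ} (t : Matrix (Fin L) (Fin L) ℝ)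
    (Q : Fin L → Matrix (Fin ζ) (Fin ζ) ℝ) (Γe : Fin L → Matrix (Fin ζ) (Fin 1) ℝ)
    (n : ℕ) (a : Fin L) (i : Fin ζ) :
    ((TblockL t ζ * QblockL Q) ^ n * (TblockL t ζ * GammaEcolL Γe)) (a, i) 0 =
      ∑ s : Fin (n + 1) → Fin L,
        (t a (s 0) * ∏ j : Fin n, t (s j.castSucc) (s j.succ)) *
          ((List.ofFn fun j : Fin n => Q (s j.castSucc)).prod * Γe (s (Fin.last n))) i 0 := by
  induction n generalizing a i with
  | zero =>
    rw [sum_fin_succ_pi, pow_zero, Matrix.one_mul, TblockL_mul_apply]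
    simp [GammaEcolL]
  | succ n ih =>
    rw [sum_fin_succ_pi, pow_succ', Matrix.mul_assoc, Matrix.mul_assoc, TblockL_mul_apply]
    refine Finset.sum_congr rfl fun b _ => ?_
    simp only [QblockL_mul_apply, ih, Finset.mul_sum]
    rw [Finset.sum_comm]
    refine Finset.sum_congr rfl fun s _ => ?_
    simp only [List.ofFn_succ, List.prod_cons, Fin.prod_univ_succ, Fin.castSucc_zero,
      Fin.cons_zero, Fin.cons_succ, ← Fin.succ_castSucc, ← Fin.succ_last, Matrix.mul_assoc]
    rw [Matrix.mul_apply, Finset.mul_sum]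
    exact Finset.sum_congr rfl fun j _ => by ring

/-- Generalized path-sum identity for `L` hidden states (equation (44) of the paper):
for every `k ≥ 2`, the sum over all state traces `s : Fin k → Fin L` of
`π_{s(0)} · (∏_{j=0}^{k-2} t(s(j), s(j+1))) · (Γ_s^{s(0)} · ∏_{j=1}^{k-2} Q^{s(j)} · Γ_e^{s(k-1)})`
equals `[π_1, …, π_L] · 𝚪_s · (𝐓 𝐐)^{k-2} · 𝐓 · 𝚪ₑᶜ`. -/
theorem path_sum_L_states (ζ : ℕ) (hζ : 1 ≤ ζ) (L : ℕ) (hL : 2 ≤ L)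
    (t : Matrix (Fin L) (Fin L) ℝ) (π : Fin L → ℝ)
    (Γs : Fin L → Matrix (Fin 1) (Fin ζ) ℝ)
    (Q : Fin L → Matrix (Fin ζ) (Fin ζ) ℝ)
    (Γe : Fin L → Matrix (Fin ζ) (Fin 1) ℝ)
    (k : ℕ) (hk : 2 ≤ k) :
    (∑ s : Fin k → Fin L,
      (π (s ⟨0, by omega⟩) *
        ∏ j : Fin (k - 1),
          t (s (Fin.castLE (by omega) j)) (s (Fin.cast (by omega) j.succ))) *
      ((Γs (s ⟨0, by omega⟩) *
          (List.ofFn fun j : Fin (k - 2) => Q (s (Fin.castLE (by omega) j.succ))).prod *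
          Γe (s ⟨k - 1, by omega⟩)) 0 0)) =
    ((Matrix.of fun (_ : Fin 1) (a : Fin L) => π a) * GammaSblockL Γs *
        (TblockL t ζ * QblockL Q) ^ (k - 2) * TblockL t ζ * GammaEcolL Γe) 0 0 := by
  obtain ⟨n, rfl⟩ := Nat.exists_eq_add_of_le' hk
  rw [Matrix.mul_assoc, Matrix.mul_assoc, Matrix.mul_assoc, Matrix.mul_apply]
  simp only [GammaSblockL_mul_apply, Matrix.of_apply, Matrix.mul_assoc, TQ_pow_mul_apply]
  refine (sum_fin_succ_pi (n := n + 1) _).trans (Finset.sum_congr rfl fun a _ => ?_)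
  simp only [Finset.mul_sum]
  rw [Finset.sum_comm]
  refine Finset.sum_congr rfl fun s _ => ?_
  have hprod : (∏ j : Fin (n + 2 - 1),
      t ((Fin.cons a s : Fin (n + 2) → Fin L) (Fin.castLE (by omega) j))
        ((Fin.cons a s : Fin (n + 2) → Fin L) (Fin.cast (by omega) j.succ))) =
      t a (s 0) * ∏ j : Fin n, t (s j.castSucc) (s j.succ) :=
    Fin.prod_univ_succ (n := n) _
  rw [hprod, Matrix.mul_apply, Finset.mul_sum]
  refine Finset.sum_congr rfl fun i _ => ?_
  change π a * _ * (Γs a 0 i *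
    ((List.ofFn fun j : Fin n => Q (s j.castSucc)).prod * Γe (s (Fin.last n))) i 0) =
    π a * (Γs a 0 i * ((t a (s 0) * ∏ j : Fin n, t (s j.castSucc) (s j.succ)) *
      ((List.ofFn fun j : Fin n => Q (s j.castSucc)).prod * Γe (s (Fin.last n))) i 0))
  ring
end

section
/- Closed form for the full-cycle state-transition matrix T_{0→0} (Proposition 3 of the paper): assume the powers (T_ζ 𝐐)^m converge to the zero matrix entrywise as m → ∞. Define R_1 = 𝚪₀₀ · T₁ and, for each k ≥ 2, let R_k be the 2×2 matrix whose (a,b)-entry is the sum over all state traces s : {0,…,k−1} → {G,B} with s(0)=a of (∏_{j=0}^{k−2} T₁(s(j), s(j+1))) · T₁(s(k−1), b) · ( Γ_s^{a} · (∏_{j=1}^{k−2} Q^{s(j)}) · Γ_e^{s(k−1)} ). Then the series ∑_{k=1}^∞ R_k converges entrywise and equals ( 𝚪₀₀ + 𝚪_s · (I_{2ζ} − T_ζ 𝐐)^{−1} · T_ζ · 𝚪_e ) · T₁. -/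
open Matrix Filter

/-- The `2ζ×2` block-diagonal matrix `𝚪_e` with diagonal blocks `Γ_e^G, Γ_e^B`. -/
noncomputable def GammaEblock {ζ : ℕ} (Γe : Fin 2 → Matrix (Fin ζ) (Fin 1) ℝ) :
    Matrix (Fin 2 × Fin ζ) (Fin 2) ℝ :=
  Matrix.of fun x b => if x.1 = b then Γe x.1 x.2 0 else 0

/-- The term `R_k`: `R_1 = 𝚪₀₀ · T₁`, and for `k ≥ 2`, `R_k` is the 2×2 matrix whose
`(a,b)`-entry is the sum, over all state traces `s` of length `k` with `s(0) = a`, of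
`(∏_{j=0}^{k-2} T₁(s(j),s(j+1))) · T₁(s(k-1), b) · (Γ_s^a · ∏_{j=1}^{k-2} Q^{s(j)} · Γ_e^{s(k-1)})`.
(`R_0` is set to `0`; it plays no role.) -/
noncomputable def Rterm {ζ : ℕ} (p r : ℝ) (Γ00 : Fin 2 → ℝ)
    (Γs : Fin 2 → Matrix (Fin 1) (Fin ζ) ℝ)
    (Q : Fin 2 → Matrix (Fin ζ) (Fin ζ) ℝ)
    (Γe : Fin 2 → Matrix (Fin ζ) (Fin 1) ℝ) : ℕ → Matrix (Fin 2) (Fin 2) ℝ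
  | 0 => 0
  | 1 => Matrix.diagonal Γ00 * T1 p r
  | (m + 2) => Matrix.of fun a b =>
      ∑ s : Fin (m + 2) → Fin 2,
        if s 0 = a then
          (∏ j : Fin (m + 1), T1 p r (s j.castSucc) (s j.succ)) *
            T1 p r (s (Fin.last (m + 1))) b *
            ((Γs a * (List.ofFn fun j : Fin m => Q (s j.succ.castSucc)).prod *
                Γe (s (Fin.last (m + 1)))) 0 0)
        else 0

/-- In a complete normed ring, if the powers of `x` tend to zero then they are summable. -/
theorem summable_pow_of_tendsto_pow_zero {R : Type*} [NormedRing R] [CompleteSpace R] {x : R}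
    (hx : Tendsto (fun m : ℕ => x ^ m) atTop (nhds 0)) : Summable fun m : ℕ => x ^ m := by
  obtain ⟨N, hN, hNpos⟩ := ((hx.norm.eventually_lt_const
    (by simp : ‖(0 : R)‖ < 1)).and (eventually_gt_atTop 0)).exists
  have : NeZero N := ⟨hNpos.ne'⟩
  have hgeom : Summable fun k : ℕ => ‖(x ^ N) ^ k‖ := summable_norm_geometric_of_norm_lt_one hN
  have hfin : Summable fun j : Fin N => ‖x ^ (j : ℕ)‖ := (hasSum_fintype _).summable
  refine (Nat.divModEquiv N).symm.summable_iff.mp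
    ((summable_mul_of_summable_norm hgeom hfin).congr fun q => ?_)
  simp [Nat.divModEquiv, pow_add, pow_mul, mul_comm]

/-- If the powers of a real square matrix tend to zero, its Neumann series converges to
`(1 - A)⁻¹`. -/
theorem Matrix.hasSum_pow_of_tendsto_pow_zero {n : Type*} [Fintype n] [DecidableEq n]
    {A : Matrix n n ℝ} (hA : Tendsto (fun m : ℕ => A ^ m) atTop (nhds 0)) :
    HasSum (fun m : ℕ => A ^ m) (1 - A)⁻¹ := by
  let _ : NormedRing (Matrix n n ℝ) := Matrix.linftyOpNormedRing
  have : @CompleteSpace (Matrix n n ℝ) PseudoMetricSpace.toUniformSpace :=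
    inferInstanceAs (CompleteSpace (n → n → ℝ))
  have hsum : Summable fun m : ℕ => A ^ m := summable_pow_of_tendsto_pow_zero hA
  rw [Matrix.inv_eq_left_inv hsum.tsum_pow_mul_one_sub]
  exact hsum.hasSum

theorem Fin.sum_univ_fun_succ {α M : Type*} [Fintype α] [AddCommMonoid M] {n : ℕ}
    (f : (Fin (n + 1) → α) → M) :
    ∑ s, f s = ∑ a, ∑ t : Fin n → α, f (Fin.cons a t) := by
  rw [← Fintype.sum_prod_type']
  exact (Fintype.sum_equiv (Fin.consEquiv fun _ => α) _ _ fun _ => rfl).symm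

theorem Tblock_mul_Qblock_apply {ζ : ℕ} (p r : ℝ) (Q : Fin 2 → Matrix (Fin ζ) (Fin ζ) ℝ)
    (a d : Fin 2) (i k : Fin ζ) :
    (Tblock p r ζ * Qblock Q) (a, i) (d, k) = T1 p r a d * Q d i k := by
  simp only [Matrix.mul_apply, Tblock, Qblock, Matrix.of_apply, Fintype.sum_prod_type]
  simp [mul_ite]

theorem Tblock_mul_GammaEblock_apply {ζ : ℕ} (p r : ℝ) (Γe : Fin 2 → Matrix (Fin ζ) (Fin 1) ℝ)
    (a c : Fin 2) (i : Fin ζ) :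
    (Tblock p r ζ * GammaEblock Γe) (a, i) c = T1 p r a c * Γe c i 0 := by
  simp only [Matrix.mul_apply, Tblock, GammaEblock, Matrix.of_apply, Fintype.sum_prod_type]
  simp [mul_ite]

theorem pow_mul_Tblock_mul_GammaEblock_mul_T1_apply {ζ : ℕ} (p r : ℝ)
    (Q : Fin 2 → Matrix (Fin ζ) (Fin ζ) ℝ) (Γe : Fin 2 → Matrix (Fin ζ) (Fin 1) ℝ)
    (b : Fin 2) (m : ℕ) (a : Fin 2) (i : Fin ζ) :
    ((Tblock p r ζ * Qblock Q) ^ m * (Tblock p r ζ * GammaEblock Γe * T1 p r)) (a, i) b =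
      ∑ t : Fin (m + 1) → Fin 2,
        T1 p r a (t 0) * (∏ j : Fin m, T1 p r (t j.castSucc) (t j.succ)) *
          T1 p r (t (Fin.last m)) b *
          ((List.ofFn fun j : Fin m => Q (t j.castSucc)).prod * Γe (t (Fin.last m))) i 0 := by
  induction m generalizing a i with
  | zero =>
    rw [pow_zero, Matrix.one_mul, Matrix.mul_apply, Fin.sum_univ_fun_succ]
    simp only [Tblock_mul_GammaEblock_apply]
    simp [mul_right_comm]
  | succ m ih =>
    rw [pow_succ', Matrix.mul_assoc, Matrix.mul_apply, Fintype.sum_prod_type,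
      Fin.sum_univ_fun_succ]
    refine Finset.sum_congr rfl fun d _ => ?_
    simp only [ih, Tblock_mul_Qblock_apply, Finset.mul_sum]
    rw [Finset.sum_comm]
    refine Finset.sum_congr rfl fun u _ => ?_
    rw [Fin.prod_univ_succ, List.ofFn_succ, List.prod_cons, Matrix.mul_assoc,
      Matrix.mul_apply (M := Q _), Finset.mul_sum]
    refine Finset.sum_congr rfl fun k _ => ?_
    simp only [← Fin.succ_last, Fin.castSucc_zero, Fin.cons_zero, Fin.cons_succ,
      ← Fin.succ_castSucc]
    ring

theorem Rterm_add_two {ζ : ℕ} (p r : ℝ) (Γ00 : Fin 2 → ℝ)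
    (Γs : Fin 2 → Matrix (Fin 1) (Fin ζ) ℝ) (Q : Fin 2 → Matrix (Fin ζ) (Fin ζ) ℝ)
    (Γe : Fin 2 → Matrix (Fin ζ) (Fin 1) ℝ) (m : ℕ) :
    Rterm p r Γ00 Γs Q Γe (m + 2) =
      GammaSblock Γs * (Tblock p r ζ * Qblock Q) ^ m *
        (Tblock p r ζ * GammaEblock Γe * T1 p r) := by
  ext a b
  rw [Matrix.mul_assoc, Matrix.mul_apply, Fintype.sum_prod_type]
  simp only [pow_mul_Tblock_mul_GammaEblock_mul_T1_apply, GammaSblock, Rterm, Matrix.of_apply,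
    ite_mul, zero_mul]
  rw [Fin.sum_univ_fun_succ]
  simp only [Fin.cons_zero, Finset.sum_ite_irrel, Finset.sum_const_zero, Finset.sum_ite_eq,
    Finset.sum_ite_eq', Finset.mem_univ, if_true, Finset.mul_sum]
  rw [Finset.sum_comm]
  refine Finset.sum_congr rfl fun u _ => ?_
  rw [Fin.prod_univ_succ, Matrix.mul_assoc, Matrix.mul_apply (M := Γs a), Finset.mul_sum]
  refine Finset.sum_congr rfl fun k _ => ?_
  simp only [← Fin.succ_last, Fin.castSucc_zero, Fin.cons_zero, Fin.cons_succ,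
    ← Fin.succ_castSucc]
  ring

/-- **Proposition 3** (closed form for the full-cycle state-transition matrix `T₀→₀`):
if `(T_ζ 𝐐)^m → 0` entrywise, then `∑_{k=1}^∞ R_k` converges entrywise and equals
`(𝚪₀₀ + 𝚪_s (I − T_ζ 𝐐)⁻¹ T_ζ 𝚪_e) · T₁`. -/
theorem T00_closed_form (ζ : ℕ) (hζ : 1 ≤ ζ) (p r : ℝ) (Γ00 : Fin 2 → ℝ)
    (Γs : Fin 2 → Matrix (Fin 1) (Fin ζ) ℝ)
    (Q : Fin 2 → Matrix (Fin ζ) (Fin ζ) ℝ)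
    (Γe : Fin 2 → Matrix (Fin ζ) (Fin 1) ℝ)
    (hconv : Tendsto (fun m : ℕ => (Tblock p r ζ * Qblock Q) ^ m) atTop (nhds 0)) :
    HasSum (fun k : ℕ => Rterm p r Γ00 Γs Q Γe (k + 1))
      ((Matrix.diagonal Γ00 +
          GammaSblock Γs * (1 - Tblock p r ζ * Qblock Q)⁻¹ * Tblock p r ζ *
            GammaEblock Γe) * T1 p r) := by
  have hgeom := Matrix.hasSum_pow_of_tendsto_pow_zero hconv
  have htail : HasSum (fun m : ℕ => Rterm p r Γ00 Γs Q Γe (m + 1 + 1))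
      (GammaSblock Γs * (1 - Tblock p r ζ * Qblock Q)⁻¹ *
        (Tblock p r ζ * GammaEblock Γe * T1 p r)) := by
    simp only [add_assoc, Nat.reduceAdd, Rterm_add_two]
    let L : Matrix (Fin 2 × Fin ζ) (Fin 2 × Fin ζ) ℝ →+ Matrix (Fin 2) (Fin 2) ℝ :=
      { toFun := fun X => GammaSblock Γs * X * (Tblock p r ζ * GammaEblock Γe * T1 p r)
        map_zero' := by simp
        map_add' := fun X Y => by rw [Matrix.mul_add, Matrix.add_mul] }
    have hL : Continuous L :=
      (continuous_const.matrix_mul continuous_id).matrix_mul continuous_const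
    exact hgeom.map L hL
  have hsum := HasSum.zero_add (f := fun k => Rterm p r Γ00 Γs Q Γe (k + 1)) htail
  rw [Matrix.add_mul]
  simpa only [Rterm, zero_add, Matrix.mul_assoc] using hsum
end

section
/- Truncated-below weighted matrix geometric series (the series evaluated in the vector 𝑏 of the E{L_{B_2}} term of Lemma 2 of the paper): let α, Δ be natural numbers and set ψ = max(Δ − α − 1, 0). Then the series ∑_{k=2}^∞ max(−α, k−Δ−1) · A^{k−2} (where max(−α, k−Δ−1) is computed in ℤ and cast to ℝ) converges entrywise and equals −α·(I − A)^{−1} + ( (I − A)^{−2} + (α + ψ − Δ)·(I − A)^{−1} ) · A^ψ. -/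
open Matrix Filter

/-- If the powers of an element of a normed ring tend to zero, they decay geometrically. -/
theorem exists_norm_pow_le_mul_pow_of_tendsto_zero {R : Type*} [NormedRing R] {a : R}
    (h : Tendsto (fun m : ℕ => a ^ m) atTop (nhds 0)) :
    ∃ C r : ℝ, 0 < r ∧ r < 1 ∧ ∀ m : ℕ, ‖a ^ m‖ ≤ C * r ^ m := by
  have hsmall : ∀ᶠ m : ℕ in atTop, ‖a ^ m‖ < 1 / 2 := by
    have := h.norm
    rw [norm_zero] at this
    exact this.eventually_lt_const (by norm_num)
  obtain ⟨N, hN, hN1⟩ := (hsmall.and (eventually_ge_atTop 1)).exists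
  have hN0 : N ≠ 0 := by lia
  set r : ℝ := (1 / 2 : ℝ) ^ ((N : ℝ)⁻¹) with hr
  have hrN : r ^ N = 1 / 2 := Real.rpow_inv_natCast_pow (by norm_num) hN0
  have hr0 : 0 < r := by positivity
  have hr1 : r < 1 := Real.rpow_lt_one (by norm_num) (by norm_num) (by positivity)
  set C : ℝ := ∑ s ∈ Finset.range N, ‖a ^ s‖ / r ^ s
  refine ⟨C, r, hr0, hr1, fun m => ?_⟩
  induction m using Nat.strong_induction_on with
  | _ m ih =>
    by_cases hm : m < N
    · rw [← div_le_iff₀ (by positivity)]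
      exact Finset.single_le_sum (f := fun s => ‖a ^ s‖ / r ^ s)
        (fun _ _ => by positivity) (Finset.mem_range.mpr hm)
    · obtain ⟨k, rfl⟩ := Nat.exists_eq_add_of_le' (not_lt.mp hm)
      calc ‖a ^ (k + N)‖ ≤ ‖a ^ k‖ * ‖a ^ N‖ := by rw [pow_add]; exact norm_mul_le _ _
        _ ≤ (C * r ^ k) * (1 / 2) := by
          have := ih k (by lia)
          gcongr
        _ = C * r ^ (k + N) := by rw [pow_add, hrN]; ring

/-- The geometric series and its derived series, for an element whose powers tend to zero. -/
theorem exists_hasSum_pow_of_tendsto_zero {R : Type*} [NormedRing R] [NormedAlgebra ℝ R]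
    [CompleteSpace R] {a : R} (h : Tendsto (fun m : ℕ => a ^ m) atTop (nhds 0)) :
    ∃ s t : R, HasSum (fun j : ℕ => a ^ j) s ∧
      HasSum (fun j : ℕ => ((j : ℝ) + 1) • a ^ j) t ∧ (1 - a) * s = 1 ∧ (1 - a) * t = s := by
  obtain ⟨C, r, hr0, hr1, hC⟩ := exists_norm_pow_le_mul_pow_of_tendsto_zero h
  have hrn : ‖r‖ < 1 := by rwa [Real.norm_of_nonneg hr0.le]
  have hs : Summable fun j : ℕ => a ^ j :=
    .of_norm_bounded ((summable_geometric_of_lt_one hr0.le hr1).mul_left C) hC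
  have hg : Summable fun j : ℕ => (j : ℝ) • a ^ j := by
    refine .of_norm_bounded ((summable_pow_mul_geometric_of_norm_lt_one 1 hrn).mul_left C)
      fun j => ?_
    rw [norm_smul, Real.norm_natCast, pow_one]
    calc (j : ℝ) * ‖a ^ j‖ ≤ j * (C * r ^ j) := by gcongr; exact hC j
      _ = C * (j * r ^ j) := by ring
  obtain ⟨s, hs⟩ := hs
  obtain ⟨g, hg⟩ := hg
  have ht : HasSum (fun j : ℕ => ((j : ℝ) + 1) • a ^ j) (g + s) := by
    simpa only [add_smul, one_smul] using hg.add hs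
  have hs' : a * s = s - 1 := by
    refine (hs.mul_left a).unique ?_
    simpa [pow_succ'] using (hasSum_nat_add_iff' 1).mpr hs
  have ht' : a * (g + s) = g := by
    refine (ht.mul_left a).unique ?_
    simpa [pow_succ'] using (hasSum_nat_add_iff' 1).mpr hg
  refine ⟨s, g + s, hs, ht, ?_, ?_⟩
  · rw [sub_mul, hs']; simp
  · rw [sub_mul, ht']; simp

/-- The matrix geometric series and its derived series, when the powers tend to zero. -/
theorem Matrix.hasSum_pow_of_tendsto_zero {ι : Type*} [Fintype ι] [DecidableEq ι]
    {A : Matrix ι ι ℝ} (h : Tendsto (fun m : ℕ => A ^ m) atTop (nhds 0)) :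
    HasSum (fun j : ℕ => A ^ j) (1 - A)⁻¹ ∧
      HasSum (fun j : ℕ => ((j : ℝ) + 1) • A ^ j) ((1 - A)⁻¹ ^ 2) := by
  let _ : NormedRing (Matrix ι ι ℝ) := Matrix.linftyOpNormedRing
  let _ : NormedAlgebra ℝ (Matrix ι ι ℝ) := Matrix.linftyOpNormedAlgebra
  obtain ⟨s, t, hs, ht, h1, h2⟩ := exists_hasSum_pow_of_tendsto_zero h
  have hinv : (1 - A)⁻¹ = s := Matrix.inv_eq_right_inv h1
  have hsq : t = s ^ 2 := by
    have h3 : s * (1 - A) = 1 := mul_eq_one_comm.mp h1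
    rw [← one_mul t, ← h3, mul_assoc, h2, sq]
  rw [hinv, ← hsq]
  exact ⟨hs, ht⟩

/-- Truncated-below weighted matrix geometric series (the series evaluated in the vector `b`
of the `E{L_{B₂}}` term of Lemma 2): if the powers of the `n×n` real matrix `A` tend to `0`
entrywise, then for natural numbers `α, Δ`, with `ψ = max(Δ − α − 1, 0)` (which is the
truncated subtraction `Δ - α - 1` in `ℕ`), the series `∑_{k=2}^∞ max(−α, k−Δ−1) · A^{k−2}`
converges entrywise and equals
`−α·(I − A)⁻¹ + ((I − A)⁻² + (α + ψ − Δ)·(I − A)⁻¹) · A^ψ`. -/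
theorem truncated_weighted_geometric_series (n : ℕ) (hn : 1 ≤ n)
    (A : Matrix (Fin n) (Fin n) ℝ)
    (hconv : Tendsto (fun m : ℕ => A ^ m) atTop (nhds 0)) (α Δ : ℕ) :
    HasSum (fun j : ℕ => ((max (-(α : ℤ)) ((j : ℤ) + 2 - (Δ : ℤ) - 1) : ℤ) : ℝ) • A ^ j)
      ((-(α : ℝ)) • (1 - A)⁻¹ +
        ((1 - A)⁻¹ ^ 2 + ((α : ℝ) + ((Δ - α - 1 : ℕ) : ℝ) - (Δ : ℝ)) • (1 - A)⁻¹) *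
          A ^ (Δ - α - 1)) := by
  obtain ⟨h0, h1⟩ := Matrix.hasSum_pow_of_tendsto_zero hconv
  set ψ := Δ - α - 1 with hψ
  have htail := (h1.add (h0.const_smul ((α : ℝ) + (ψ : ℝ) - (Δ : ℝ)))).mul_right (A ^ ψ)
  have hpos : HasSum
      (fun j : ℕ => ((max 0 ((j : ℤ) + 1 - (Δ : ℤ) + (α : ℤ)) : ℤ) : ℝ) • A ^ j)
      (((1 - A)⁻¹ ^ 2 + ((α : ℝ) + (ψ : ℝ) - (Δ : ℝ)) • (1 - A)⁻¹) * A ^ ψ) := by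
    rw [← (add_left_injective ψ).hasSum_iff]
    · refine htail.congr_fun fun j => ?_
      have hmax : max 0 (((j + ψ : ℕ) : ℤ) + 1 - (Δ : ℤ) + (α : ℤ))
          = (j : ℤ) + 1 + (α + ψ - Δ) := by lia
      rw [Function.comp_apply, hmax, ← add_smul, smul_mul_assoc, ← pow_add]
      push_cast
      rfl
    · intro j hj
      have hlt : j < ψ := by
        by_contra! hle
        exact hj ⟨j - ψ, Nat.sub_add_cancel hle⟩
      have hmax : max 0 ((j : ℤ) + 1 - (Δ : ℤ) + (α : ℤ)) = 0 := by lia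
      rw [hmax, Int.cast_zero, zero_smul]
  refine ((h0.const_smul (-(α : ℝ))).add hpos).congr_fun fun j => ?_
  have hmax : max (-(α : ℤ)) ((j : ℤ) + 2 - (Δ : ℤ) - 1)
      = -(α : ℤ) + max 0 ((j : ℤ) + 1 - (Δ : ℤ) + (α : ℤ)) := by lia
  rw [hmax, ← add_smul]
  push_cast
  rfl
end

section
/- Solution of the iterative equation for the conditional expectations E{Λ_t | A_l} (equation (E(Lambda|1)) derived in Appendix C of the paper): let T be an n×n real matrix (n ≥ 1) whose powers T^m converge to the zero matrix entrywise, let π be a 1×n real row vector, m and c be n×1 real column vectors, and let x : {1,2,3,…} → ℝ be a bounded sequence satisfying x(1) = π·m + (π·c)·x(2) and, for every l ≥ 2, (π·T^{l−2}·c)·x(l) = π·T^{l−1}·m + (π·T^{l−1}·c)·x(l+1), where all matrix products of a row vector, powers of T, and a column vector are read as real numbers. Then I − T is invertible and x(1) = π·(I − T)^{−1}·m. -/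
open Matrix Filter

/-- If the powers of a square real matrix `T` tend to zero, then `1 - T` is invertible. -/
theorem isUnit_one_sub_of_tendsto_pow {ι : Type*} [Fintype ι] [DecidableEq ι]
    {T : Matrix ι ι ℝ} (hconv : Tendsto (fun m : ℕ => T ^ m) atTop (nhds 0)) :
    IsUnit (1 - T) := by
  have hdet : Tendsto (fun m : ℕ => (1 - T ^ m).det) atTop (nhds 1) := by
    have hcont : Continuous fun A : Matrix ι ι ℝ => (1 - A).det := by fun_prop
    simpa [Function.comp_def] using (hcont.tendsto 0).comp hconv
  obtain ⟨m, hm⟩ := (hdet.eventually_ne one_ne_zero).exists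
  rw [← mul_neg_geom_sum T m, det_mul] at hm
  exact (isUnit_iff_isUnit_det _).2 (left_ne_zero_of_mul hm).isUnit

/-- If the powers of a square real matrix `T` tend to zero, then its Neumann series converges
to `(1 - T)⁻¹`. -/
theorem tendsto_geom_sum_inv_one_sub {ι : Type*} [Fintype ι] [DecidableEq ι]
    {T : Matrix ι ι ℝ} (hconv : Tendsto (fun m : ℕ => T ^ m) atTop (nhds 0)) :
    Tendsto (fun m : ℕ => ∑ i ∈ Finset.range m, T ^ i) atTop (nhds (1 - T)⁻¹) := by
  have hdet := (isUnit_iff_isUnit_det _).1 (isUnit_one_sub_of_tendsto_pow hconv)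
  have hsum (m : ℕ) : (1 - T)⁻¹ * (1 - T ^ m) = ∑ i ∈ Finset.range m, T ^ i := by
    rw [← mul_neg_geom_sum T m, nonsing_inv_mul_cancel_left _ _ hdet]
  have hcont : Continuous fun A : Matrix ι ι ℝ => (1 - T)⁻¹ * (1 - A) := by fun_prop
  simpa [Function.comp_def, hsum] using (hcont.tendsto 0).comp hconv

/-- Solution of the iterative equation for the conditional expectations `E{Λ_t | A_l}`
(equation "(E(Lambda|1))" in Appendix C): let `T` be an `n×n` real matrix whose powers tend
to `0` entrywise, `π` a `1×n` row vector, `mv`, `cv` `n×1` column vectors, and `x` a bounded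
sequence (on indices `l ≥ 1`) satisfying
`x(1) = π·mv + (π·cv)·x(2)` and, for every `l ≥ 2`,
`(π·T^{l−2}·cv)·x(l) = π·T^{l−1}·mv + (π·T^{l−1}·cv)·x(l+1)`.
Then `I − T` is invertible and `x(1) = π·(I − T)⁻¹·mv`. -/
theorem iterative_equation_solution (n : ℕ) (hn : 1 ≤ n)
    (T : Matrix (Fin n) (Fin n) ℝ)
    (hconv : Tendsto (fun m : ℕ => T ^ m) atTop (nhds 0))
    (π : Matrix (Fin 1) (Fin n) ℝ) (mv cv : Matrix (Fin n) (Fin 1) ℝ)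
    (x : ℕ → ℝ) (hbdd : ∃ C : ℝ, ∀ l : ℕ, 1 ≤ l → |x l| ≤ C)
    (h1 : x 1 = (π * mv) 0 0 + (π * cv) 0 0 * x 2)
    (hrec : ∀ l : ℕ, 2 ≤ l →
      (π * T ^ (l - 2) * cv) 0 0 * x l =
        (π * T ^ (l - 1) * mv) 0 0 + (π * T ^ (l - 1) * cv) 0 0 * x (l + 1)) :
    IsUnit (1 - T) ∧ x 1 = (π * (1 - T)⁻¹ * mv) 0 0 := by
  refine ⟨isUnit_one_sub_of_tendsto_pow hconv, ?_⟩
  have hunroll (k : ℕ) : x 1 = (π * (∑ i ∈ Finset.range (k + 1), T ^ i) * mv) 0 0 +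
      (π * T ^ k * cv) 0 0 * x (k + 2) := by
    induction k with
    | zero => simpa using h1
    | succ k ih =>
      have h := hrec (k + 2) (by omega)
      simp only [Nat.add_sub_cancel, show k + 2 - 1 = k + 1 by omega] at h
      rw [Finset.sum_range_succ, Matrix.mul_add, Matrix.add_mul, Matrix.add_apply, ih, h]
      ring
  have hsum : Tendsto (fun k : ℕ => (π * (∑ i ∈ Finset.range (k + 1), T ^ i) * mv) 0 0) atTop
      (nhds ((π * (1 - T)⁻¹ * mv) 0 0)) := by
    have hcont : Continuous fun A : Matrix (Fin n) (Fin n) ℝ => (π * A * mv) 0 0 :=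
      Continuous.matrix_elem (by fun_prop) 0 0
    exact (hcont.tendsto _).comp
      ((tendsto_geom_sum_inv_one_sub hconv).comp (tendsto_add_atTop_nat 1))
  have hrem : Tendsto (fun k : ℕ => (π * T ^ k * cv) 0 0 * x (k + 2)) atTop (nhds 0) := by
    obtain ⟨C, hC⟩ := hbdd
    have hcont : Continuous fun A : Matrix (Fin n) (Fin n) ℝ => (π * A * cv) 0 0 :=
      Continuous.matrix_elem (by fun_prop) 0 0
    have hcoeff : Tendsto (fun k : ℕ => (π * T ^ k * cv) 0 0) atTop (nhds 0) := by
      simpa [Function.comp_def] using (hcont.tendsto 0).comp hconv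
    exact hcoeff.zero_mul_isBoundedUnder_le
      (isBoundedUnder_of ⟨C, fun k => hC (k + 2) (by omega)⟩)
  have hlim := hsum.add hrem
  simp only [← hunroll, add_zero] at hlim
  exact tendsto_nhds_unique tendsto_const_nhds hlim
end

section
/- Spectrum of the K-banded Toeplitz transition matrix (Lemma 5 of the paper): let K ≥ 1 and n_K ≥ 1 be integers, β an integer with 0 ≤ β < K, n = K·n_K + β, and p ∈ (0,1) a real number. Let A be the n×n real matrix indexed by {0,…,n−1} with A(i,j) = 1−p if j = i + K, A(i,j) = p if i = j + K, and A(i,j) = 0 otherwise. Then the characteristic polynomial of A in ℝ[X] factors as ∏_{m=1}^{n_K} (X − 2√(p(1−p))·cos(mπ/(n_K+1)))^{K−β} · ∏_{m=1}^{n_K+1} (X − 2√(p(1−p))·cos(mπ/(n_K+2)))^{β}; equivalently, the eigenvalues of A are 2√(p(1−p))·cos(mπ/(n_K+1)) with multiplicity K−β for m = 1,…,n_K, together with 2√(p(1−p))·cos(mπ/(n_K+2)) with multiplicity β for m = 1,…,n_K+1. -/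
open Matrix Polynomial

/-- The tridiagonal Toeplitz matrix with zero diagonal, superdiagonal `a` and subdiagonal `b`. -/
def tridiagonalToeplitz {R : Type*} [Zero R] (a b : R) (N : ℕ) : Matrix (Fin N) (Fin N) R :=
  Matrix.of fun i j =>
    if (j : ℕ) = (i : ℕ) + 1 then a else if (i : ℕ) = (j : ℕ) + 1 then b else 0

theorem charmatrix_tridiagonalToeplitz_apply {R : Type*} [CommRing R] (a b : R) (N : ℕ)
    (i j : Fin N) :
    (tridiagonalToeplitz a b N).charmatrix i j =
      if (i : ℕ) = j then X else if (j : ℕ) = (i : ℕ) + 1 then -C a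
        else if (i : ℕ) = (j : ℕ) + 1 then -C b else 0 := by
  simp only [charmatrix_apply, diagonal_apply, tridiagonalToeplitz, of_apply, Fin.ext_iff]
  split_ifs <;> first | omega | simp

theorem charpoly_tridiagonalToeplitz_add_two {R : Type*} [CommRing R] (a b : R) (N : ℕ) :
    (tridiagonalToeplitz a b (N + 2)).charpoly =
      X * (tridiagonalToeplitz a b (N + 1)).charpoly -
        C (a * b) * (tridiagonalToeplitz a b N).charpoly := by
  have hminor : (tridiagonalToeplitz a b (N + 2)).charmatrix.submatrix Fin.succ
      (Fin.succAbove 0) = (tridiagonalToeplitz a b (N + 1)).charmatrix := by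
    ext1 i j
    simp [charmatrix_tridiagonalToeplitz_apply]
  have hminor' : (((tridiagonalToeplitz a b (N + 2)).charmatrix.submatrix Fin.succ
      (Fin.succAbove 1)).submatrix (Fin.succAbove 0) Fin.succ) =
        (tridiagonalToeplitz a b N).charmatrix := by
    ext1 i j
    have h : (Fin.succAbove (1 : Fin (N + 2)) j.succ) = j.succ.succ := by
      rw [← Fin.succ_zero_eq_one, Fin.succ_succAbove_succ]; simp
    simp [charmatrix_tridiagonalToeplitz_apply, h]
  have hdet : ((tridiagonalToeplitz a b (N + 2)).charmatrix.submatrix Fin.succ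
      (Fin.succAbove 1)).det = -C b * (tridiagonalToeplitz a b N).charpoly := by
    rw [det_succ_column_zero, Fin.sum_univ_succ, Finset.sum_eq_zero]
    · rw [hminor', ← Matrix.charpoly]
      simp [tridiagonalToeplitz]
    · intro i _
      simp [tridiagonalToeplitz]
  rw [Matrix.charpoly, det_succ_row_zero, Fin.sum_univ_succ, Fin.sum_univ_succ,
    Finset.sum_eq_zero]
  · rw [hminor, ← Matrix.charpoly, Fin.succ_zero_eq_one, hdet]
    simp [tridiagonalToeplitz]
    ring
  · intro i _
    rw [charmatrix_tridiagonalToeplitz_apply]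
    simp

theorem charpoly_tridiagonalToeplitz_eq_chebyshev {F : Type*} [Field F] [NeZero (2 : F)]
    {a b s : F} (hs : s ≠ 0) (hab : a * b = s ^ 2) (N : ℕ) :
    (tridiagonalToeplitz a b N).charpoly =
      C (s ^ N) * (Chebyshev.U F N).comp (C (2 * s)⁻¹ * X) := by
  have h2 : (2 : F) ≠ 0 := NeZero.ne 2
  have hC : (2 : F[X]) * C (2 * s)⁻¹ * C s = 1 := by
    rw [← C_ofNat, ← C_mul, ← C_mul, mul_inv, mul_inv_cancel_left₀ h2, inv_mul_cancel₀ hs, C_1]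
  induction N using Nat.twoStepInduction with
  | zero => simp
  | one =>
    have : (tridiagonalToeplitz a b 1).charpoly = X := by
      simp [Matrix.charpoly, tridiagonalToeplitz]
    rw [this]
    simp only [Nat.cast_one, Chebyshev.U_one, mul_comp, ofNat_comp, X_comp, pow_one]
    linear_combination -X * hC
  | more N ih1 ih2 =>
    rw [charpoly_tridiagonalToeplitz_add_two, ih1, ih2, hab]
    push_cast
    rw [Chebyshev.U_add_two]
    simp only [sub_comp, mul_comp, ofNat_comp, X_comp, C_pow]
    linear_combination (-X * C s ^ (N + 1) * (Chebyshev.U F (N + 1)).comp (C (2 * s)⁻¹ * X)) * hC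

theorem chebyshev_U_real_eq_prod (N : ℕ) :
    Chebyshev.U ℝ N =
      C (2 ^ N) * ∏ k ∈ Finset.range N, (X - C (Real.cos ((k + 1) * Real.pi / (N + 1)))) := by
  have hinj := (Finset.range N).nodup_map_iff_injOn.mp (Chebyshev.roots_U_real_nodup N)
  have hcard : Multiset.card (Chebyshev.U ℝ N).roots = (Chebyshev.U ℝ N).natDegree := by
    rw [Chebyshev.roots_U_real, Finset.card_val, Finset.card_image_of_injOn hinj,
      Finset.card_range, Chebyshev.natDegree_U_natCast]
  rw [← C_leadingCoeff_mul_prod_multiset_X_sub_C hcard, Chebyshev.leadingCoeff_U_natCast,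
    Chebyshev.roots_U_real]
  congr 1
  exact Finset.prod_image hinj

theorem charpoly_tridiagonalToeplitz_real {a b s : ℝ} (hs : s ≠ 0) (hab : a * b = s ^ 2)
    (N : ℕ) :
    (tridiagonalToeplitz a b N).charpoly =
      ∏ m ∈ Finset.Icc 1 N, (X - C (2 * s * Real.cos (m * Real.pi / (N + 1)))) := by
  have hC : (C (2 * s) : ℝ[X]) * C (2 * s)⁻¹ = 1 := by
    rw [← C_mul, mul_inv_cancel₀ (by simpa using hs), C_1]
  rw [charpoly_tridiagonalToeplitz_eq_chebyshev hs hab, chebyshev_U_real_eq_prod, mul_comp,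
    C_comp, ← mul_assoc, ← C_mul, ← mul_pow, mul_comm s, C_pow, prod_comp,
    ← Finset.Ico_add_one_right_eq_Icc, Finset.prod_Ico_eq_prod_range, Nat.add_sub_cancel]
  nth_rw 1 [← Finset.card_range N]
  rw [← Finset.prod_const, ← Finset.prod_mul_distrib]
  refine Finset.prod_congr rfl fun k _ => ?_
  rw [C_mul (a := 2 * s), sub_comp, X_comp, C_comp, Nat.cast_add, Nat.cast_one, add_comm (1 : ℝ)]
  linear_combination X * hC

/-- The elements of `{0, …, n - 1}` congruent to `r` modulo `K`, enumerated increasingly. -/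
def finModClassEquiv {K n r L : ℕ} (hr : r < K) (hL : ∀ q, r + K * q < n ↔ q < L) :
    {i : Fin n // (i : ℕ) % K = r} ≃ Fin L where
  toFun i := ⟨(i.1 : ℕ) / K, (hL _).1 (by
    have h := Nat.mod_add_div (i.1 : ℕ) K
    rw [i.2] at h
    exact h.trans_lt i.1.2)⟩
  invFun q := ⟨⟨r + K * q, (hL q).2 q.2⟩, by simp [Nat.mod_eq_of_lt hr]⟩
  left_inv i := by
    have h := Nat.mod_add_div (i.1 : ℕ) K
    rw [i.2] at h
    exact Subtype.ext (Fin.ext h)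
  right_inv q := by
    ext
    simp [Nat.add_mul_div_left _ _ (Nat.zero_lt_of_lt hr), Nat.div_eq_of_lt hr]

/-- The Toeplitz matrix whose only nonzero diagonals are those at distance `K` from the main one,
with entries `a` above and `b` below. -/
def bandedToeplitz {R : Type*} [Zero R] (a b : R) (K n : ℕ) : Matrix (Fin n) (Fin n) R :=
  Matrix.of fun i j =>
    if (j : ℕ) = (i : ℕ) + K then a else if (i : ℕ) = (j : ℕ) + K then b else 0

theorem blockTriangular_bandedToeplitz {R : Type*} [Zero R] (a b : R) (K n : ℕ) :
    (bandedToeplitz a b K n).BlockTriangular fun i => (i : ℕ) % K := by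
  intro i j hij
  simp only [bandedToeplitz, of_apply]
  split_ifs with h h
  · simp [h] at hij
  · simp [h] at hij
  · rfl

theorem charpoly_toSquareBlock_bandedToeplitz {R : Type*} [CommRing R] (a b : R)
    {K n r L : ℕ} (hr : r < K) (hL : ∀ q, r + K * q < n ↔ q < L) :
    ((bandedToeplitz a b K n).toSquareBlock (fun i => (i : ℕ) % K) r).charpoly =
      (tridiagonalToeplitz a b L).charpoly := by
  rw [← charpoly_reindex (finModClassEquiv hr hL)]
  congr 1
  ext i j
  have hK : 0 < K := Nat.zero_lt_of_lt hr
  have key (x y : ℕ) : r + K * x = r + K * y + K ↔ x = y + 1 := by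
    rw [add_assoc, ← mul_add_one, Nat.add_left_cancel_iff, Nat.mul_right_inj hK.ne']
  simp [toSquareBlock_def, bandedToeplitz, tridiagonalToeplitz, finModClassEquiv, key]

theorem charpoly_bandedToeplitz {R : Type*} [CommRing R] (a b : R) {K q β : ℕ} (hq : 1 ≤ q)
    (hβ : β < K) :
    (bandedToeplitz a b K (K * q + β)).charpoly =
      (tridiagonalToeplitz a b q).charpoly ^ (K - β) *
        (tridiagonalToeplitz a b (q + 1)).charpoly ^ β := by
  have hK : 0 < K := Nat.zero_lt_of_lt hβ
  have himage : Finset.univ.image (fun i : Fin (K * q + β) => (i : ℕ) % K) =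
      Finset.range K := by
    ext r
    simp only [Finset.mem_image, Finset.mem_univ, true_and, Finset.mem_range]
    refine ⟨fun ⟨i, hi⟩ => hi ▸ Nat.mod_lt _ hK, fun hr => ⟨⟨r, ?_⟩, Nat.mod_eq_of_lt hr⟩⟩
    nlinarith
  rw [(blockTriangular_bandedToeplitz a b K _).charpoly, himage,
    ← Finset.prod_range_mul_prod_Ico _ hβ.le, mul_comm]
  congr 1
  · rw [← Nat.card_Ico]
    refine Finset.prod_eq_pow_card fun r hr => ?_
    obtain ⟨h1, h2⟩ := Finset.mem_Ico.1 hr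
    refine charpoly_toSquareBlock_bandedToeplitz a b h2 fun x => ⟨fun h => ?_, fun h => ?_⟩
    · by_contra! hx
      nlinarith
    · nlinarith
  · refine (Finset.prod_eq_pow_card fun r hr => ?_).trans (by rw [Finset.card_range])
    have h1 := Finset.mem_range.1 hr
    refine charpoly_toSquareBlock_bandedToeplitz a b (h1.trans hβ) fun x =>
      ⟨fun h => ?_, fun h => ?_⟩
    · by_contra! hx
      nlinarith
    · nlinarith

/-- **Lemma 5** (spectrum of the `K`-banded Toeplitz transition matrix): for integers
`K ≥ 1`, `n_K ≥ 1`, `0 ≤ β < K`, `n = K·n_K + β`, and `p ∈ (0,1)`, the `n×n` matrix `A`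
with `A(i,j) = 1−p` if `j = i + K`, `A(i,j) = p` if `i = j + K`, and `0` otherwise, has
characteristic polynomial
`∏_{m=1}^{n_K} (X − 2√(p(1−p))·cos(mπ/(n_K+1)))^{K−β} ·
 ∏_{m=1}^{n_K+1} (X − 2√(p(1−p))·cos(mπ/(n_K+2)))^{β}`. -/
theorem banded_toeplitz_charpoly (K nK β : ℕ) (hK : 1 ≤ K) (hnK : 1 ≤ nK) (hβ : β < K)
    (p : ℝ) (hp0 : 0 < p) (hp1 : p < 1) :
    Matrix.charpoly
      (Matrix.of fun i j : Fin (K * nK + β) =>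
        if (j : ℕ) = (i : ℕ) + K then 1 - p
        else if (i : ℕ) = (j : ℕ) + K then p else (0 : ℝ)) =
    (∏ m ∈ Finset.Icc 1 nK,
        (X - C (2 * Real.sqrt (p * (1 - p)) *
          Real.cos ((m : ℝ) * Real.pi / ((nK : ℝ) + 1)))) ^ (K - β)) *
    (∏ m ∈ Finset.Icc 1 (nK + 1),
        (X - C (2 * Real.sqrt (p * (1 - p)) *
          Real.cos ((m : ℝ) * Real.pi / ((nK : ℝ) + 2)))) ^ β) := by
  have hpos : 0 < p * (1 - p) := mul_pos hp0 (sub_pos.2 hp1)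
  have hs : Real.sqrt (p * (1 - p)) ≠ 0 := (Real.sqrt_pos.2 hpos).ne'
  have hab : (1 - p) * p = Real.sqrt (p * (1 - p)) ^ 2 := by
    rw [Real.sq_sqrt hpos.le, mul_comm]
  have hcast : ((nK + 1 : ℕ) : ℝ) + 1 = nK + 2 := by push_cast; ring
  have h := charpoly_bandedToeplitz (1 - p) p hnK hβ
  rw [charpoly_tridiagonalToeplitz_real hs hab, charpoly_tridiagonalToeplitz_real hs hab,
    hcast, ← Finset.prod_pow, ← Finset.prod_pow] at h
  exact h
end

section
/- Series–integral identity for the expected return time of the information debt (Lemma 5 'E{t_{i_0+1} − t_{i_0}}' of the paper, in the regime α → ∞ and coding rate K/N = 1/2): for every real p with 1/2 < p < 1, the series ∑_{l=1}^∞ 2l · C_{l−1} · (p(1−p))^l converges absolutely and ∑_{l=1}^∞ 2l · C_{l−1} · (p(1−p))^l = 2p(1−p) · ∫_0^1 ( 1 + 1/(1 − 2√(p(1−p))·cos(πx)) ) · sin²(πx) / (1 − 2√(p(1−p))·cos(πx)) dx. (Adding p to both sides gives the paper's formula for the expected return time E{t_{i_0+1} − t_{i_0}} = p + 2p(1−p)·∫_0^1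 (1 + 1/(1−2√(p(1−p))cos πx)) · sin²(πx)/(1−2√(p(1−p))cos πx) dx, since the return time equals 1 with probability p and equals 2l with probability C_{l−1}(p(1−p))^l for each l ≥ 1.) -/
open Real

/-- The closed form of the Wallis integral over a half period, for even exponents. -/
lemma integral_cos_pow_even_zero_pi (l : ℕ) :
    ∫ x in (0 : ℝ)..π, cos x ^ (2 * l) = π * l.centralBinom / 4 ^ l := by
  induction l with
  | zero => simp
  | succ l ih =>
    have h : ((l : ℝ) + 1) * (l + 1).centralBinom = 2 * (2 * l + 1) * l.centralBinom := by
      exact_mod_cast Nat.succ_mul_centralBinom_succ l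
    have hl : (l : ℝ) + 1 ≠ 0 := by positivity
    rw [show 2 * (l + 1) = 2 * l + 2 by ring, integral_cos_pow, ih]
    simp only [sin_zero, sin_pi, mul_zero, sub_zero, zero_div, zero_add]
    push_cast
    rw [pow_succ]
    field_simp
    linear_combination -2 * h

lemma integral_cos_pow_odd_zero_pi (l : ℕ) :
    ∫ x in (0 : ℝ)..π, cos x ^ (2 * l + 1) = 0 := by
  induction l with
  | zero => simp
  | succ l ih =>
    rw [show 2 * (l + 1) + 1 = 2 * l + 1 + 2 by ring, integral_cos_pow, ih]
    simp

lemma integral_cos_pi_mul_pow_mul_sin_sq (m : ℕ) :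
    ∫ x in (0 : ℝ)..1, cos (π * x) ^ m * sin (π * x) ^ 2 =
      π⁻¹ * ((∫ x in (0 : ℝ)..π, cos x ^ m) / (m + 2)) := by
  have hm : (m : ℝ) + 2 ≠ 0 := by positivity
  rw [intervalIntegral.integral_comp_mul_left (fun y => cos y ^ m * sin y ^ 2) pi_ne_zero,
    mul_zero, mul_one, smul_eq_mul]
  congr 1
  have h : ∀ y : ℝ, cos y ^ m * sin y ^ 2 = cos y ^ m - cos y ^ (m + 2) := fun y => by
    rw [sin_sq]; ring
  simp_rw [h]
  rw [intervalIntegral.integral_sub (Continuous.intervalIntegrable (by fun_prop) _ _)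
    (Continuous.intervalIntegrable (by fun_prop) _ _), integral_cos_pow]
  simp only [sin_zero, sin_pi, mul_zero, sub_zero, zero_div, zero_add]
  field_simp
  ring

lemma integral_cos_pi_mul_pow_odd_mul_sin_sq (l : ℕ) :
    ∫ x in (0 : ℝ)..1, cos (π * x) ^ (2 * l + 1) * sin (π * x) ^ 2 = 0 := by
  rw [integral_cos_pi_mul_pow_mul_sin_sq, integral_cos_pow_odd_zero_pi]
  simp

lemma integral_cos_pi_mul_pow_even_mul_sin_sq (l : ℕ) :
    ∫ x in (0 : ℝ)..1, cos (π * x) ^ (2 * l) * sin (π * x) ^ 2 =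
      catalan l / (2 * 4 ^ l) := by
  have h : ((l : ℝ) + 1) * catalan l = l.centralBinom := by
    exact_mod_cast succ_mul_catalan_eq_centralBinom l
  have hl : (l : ℝ) + 1 ≠ 0 := by positivity
  rw [integral_cos_pi_mul_pow_mul_sin_sq, integral_cos_pow_even_zero_pi, ← h]
  push_cast
  field_simp

lemma hasSum_add_two_mul_geometric {r : ℝ} (hr : |r| < 1) :
    HasSum (fun m : ℕ => ((m : ℝ) + 2) * r ^ m) ((1 + 1 / (1 - r)) / (1 - r)) := by
  have hr' : 1 - r ≠ 0 := by linarith [(abs_lt.mp hr).2]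
  convert! (hasSum_coe_mul_geometric_of_norm_lt_one (r := r) hr).add
    ((hasSum_geometric_of_abs_lt_one hr).mul_left 2) using 1
  · ext m; ring
  · field_simp
    ring

lemma hasSum_catalan_mul_pow {t : ℝ} (ht0 : 0 ≤ t) (ht : 2 * t < 1) :
    HasSum (fun l : ℕ => ((l : ℝ) + 1) * catalan l * (t ^ 2) ^ l)
      (∫ x in (0 : ℝ)..1, (1 + 1 / (1 - 2 * t * cos (π * x))) * sin (π * x) ^ 2 /
        (1 - 2 * t * cos (π * x))) := by
  have habs : |2 * t| < 1 := by rwa [abs_of_nonneg (by positivity)]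
  have hcos (x : ℝ) : |2 * t * cos (π * x)| ≤ 2 * t := by
    rw [abs_mul, abs_of_nonneg (by positivity : 0 ≤ 2 * t)]
    exact mul_le_of_le_one_right (by positivity) (abs_cos_le_one _)
  have key := intervalIntegral.hasSum_integral_of_dominated_convergence
    (μ := MeasureTheory.volume) (a := 0) (b := 1)
    (F := fun (m : ℕ) x => ((m : ℝ) + 2) * (2 * t * cos (π * x)) ^ m * sin (π * x) ^ 2)
    (f := fun x => (1 + 1 / (1 - 2 * t * cos (π * x))) * sin (π * x) ^ 2 /
        (1 - 2 * t * cos (π * x)))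
    (fun m _ => ((m : ℝ) + 2) * (2 * t) ^ m)
    (fun m => Continuous.aestronglyMeasurable (by fun_prop))
    (fun m => .of_forall fun x _ => by
      rw [norm_eq_abs, abs_mul, abs_mul, abs_pow, abs_of_nonneg (by positivity : (0 : ℝ) ≤ m + 2),
        abs_of_nonneg (sq_nonneg (sin (π * x)))]
      calc _ ≤ ((m : ℝ) + 2) * |2 * t * cos (π * x)| ^ m :=
            mul_le_of_le_one_right (by positivity) (sin_sq_le_one _)
        _ ≤ _ := by gcongr; exact hcos x)
    (.of_forall fun _ _ => (hasSum_add_two_mul_geometric habs).summable)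
    (by simp)
    (.of_forall fun x _ => by
      rw [mul_div_right_comm]
      exact (hasSum_add_two_mul_geometric ((hcos x).trans_lt ht)).mul_right _)
  have hF (m : ℕ) : ∫ x in (0 : ℝ)..1,
      ((m : ℝ) + 2) * (2 * t * cos (π * x)) ^ m * sin (π * x) ^ 2 =
      ((m : ℝ) + 2) * (2 * t) ^ m * ∫ x in (0 : ℝ)..1, cos (π * x) ^ m * sin (π * x) ^ 2 := by
    rw [← intervalIntegral.integral_const_mul]
    congr 1 with x
    ring
  simp_rw [hF] at key
  rw [← (mul_right_injective₀ (two_ne_zero' ℕ)).hasSum_iff] at key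
  · convert! key using 1
    ext l
    simp only [Function.comp_apply]
    rw [integral_cos_pi_mul_pow_even_mul_sin_sq, pow_mul (2 * t), mul_pow 2 t, mul_pow]
    push_cast
    norm_num
    field_simp
  · intro m hm
    obtain ⟨l, rfl | rfl⟩ := m.even_or_odd'
    · exact absurd ⟨l, rfl⟩ hm
    · rw [integral_cos_pi_mul_pow_odd_mul_sin_sq, mul_zero]

/-- Series–integral identity for the expected return time of the information debt
(Lemma 'E{t_{i₀+1} − t_{i₀}}', regime `α → ∞`, coding rate `1/2`): for `1/2 < p < 1`,
the series `∑_{l=1}^∞ 2l·C_{l−1}·(p(1−p))^l` (here reindexed as `l+1`, `l : ℕ`) converges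
absolutely, and equals
`2p(1−p)·∫₀¹ (1 + 1/(1 − 2√(p(1−p))·cos(πx))) · sin²(πx)/(1 − 2√(p(1−p))·cos(πx)) dx`. -/
theorem catalan_series_integral_identity (p : ℝ) (hp : 1 / 2 < p) (hp1 : p < 1) :
    Summable (fun l : ℕ =>
      |2 * ((l : ℝ) + 1) * (catalan l : ℝ) * (p * (1 - p)) ^ (l + 1)|) ∧
    (∑' l : ℕ, 2 * ((l : ℝ) + 1) * (catalan l : ℝ) * (p * (1 - p)) ^ (l + 1)) =
      2 * p * (1 - p) *
        ∫ x in (0 : ℝ)..1,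
          (1 + 1 / (1 - 2 * Real.sqrt (p * (1 - p)) * Real.cos (Real.pi * x))) *
            (Real.sin (Real.pi * x)) ^ 2 /
              (1 - 2 * Real.sqrt (p * (1 - p)) * Real.cos (Real.pi * x)) := by
  have hq : 0 ≤ p * (1 - p) := mul_nonneg (by linarith) (by linarith)
  have ht : 2 * √(p * (1 - p)) < 1 := by
    have : √(p * (1 - p)) < 1 / 2 := (sqrt_lt' (by norm_num)).mpr (by nlinarith)
    linarith
  have h := (hasSum_catalan_mul_pow (sqrt_nonneg _) ht).mul_left (2 * p * (1 - p))
  have hterm : (fun l : ℕ => 2 * p * (1 - p) *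
      (((l : ℝ) + 1) * catalan l * (√(p * (1 - p)) ^ 2) ^ l)) =
      fun l : ℕ => 2 * ((l : ℝ) + 1) * (catalan l : ℝ) * (p * (1 - p)) ^ (l + 1) := by
    ext l
    rw [sq_sqrt hq]
    ring
  rw [hterm] at h
  exact ⟨h.summable.abs, h.tsum_eq⟩
end

section
/- Closed form for the total number of up-steps among the first 2l−Δ−1 positions over all first-return paths (equation (174)/(80) in Appendix E of the paper, the combinatorial core of Lemma 'E{N_e}'): for all integers Δ ≥ 1 and l ≥ 1 with 2l ≥ Δ + 2, one has ∑_{j=1}^{2l−Δ−1} N_up(l, j) = (2l−Δ−1)·C_{l−1} − ∑_{i=0}^{l−⌈Δ/2⌉−2} C_i · C_{l−2−i} · (2l−Δ−3−2i), where the second sum is empty when l − ⌈Δ/2⌉ − 2 < 0. -/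
/-- Partial sum `S_t = ∑_{i=1}^{t} w(i)` of a ±1 path `w` (steps are encoded as units of `ℤ`,
i.e. elements of `ℤˣ = {+1, −1}`; `w i` is the step at time `i+1`). -/
def psum {n : ℕ} (w : Fin n → ℤˣ) (t : ℕ) : ℤ :=
  ∑ i ∈ Finset.univ.filter (fun i : Fin n => (i : ℕ) < t), ((w i : ℤ))

/-- `N_up(l, j)`: the number of valid `2l`-paths whose `j`-th step (1-indexed) is `+1`.
A valid `2l`-path is a map `w : {1,…,2l} → {+1,−1}` whose partial sums satisfy `S_t > 0`
for `1 ≤ t ≤ 2l−1` and `S_{2l} = 0`. -/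
noncomputable def Nup (l j : ℕ) : ℕ :=
  Nat.card {w : Fin (2 * l) → ℤˣ //
    ((∀ t : ℕ, 1 ≤ t → t ≤ 2 * l - 1 → 0 < psum w t) ∧ psum w (2 * l) = 0) ∧
    ∀ i : Fin (2 * l), (i : ℕ) + 1 = j → w i = 1}

/-- The number of `±1` paths of length `m` which start at height `h`, stay nonnegative before the
last step, and end at height `-1`. -/
def exitCount : ℕ → ℤ → ℕ
  | 0, h => if h = -1 then 1 else 0
  | m + 1, h => if 0 ≤ h then exitCount m (h + 1) + exitCount m (h - 1) else 0

/-- The number of paths counted by `exitCount m h` whose step with (0-based) index `j` is `+1`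
(no condition if `m ≤ j`). -/
def exitUpCount : ℕ → ℕ → ℤ → ℕ
  | 0, _, h => exitCount 0 h
  | m + 1, 0, h => if 0 ≤ h then exitCount m (h + 1) else 0
  | m + 1, j + 1, h => if 0 ≤ h then exitUpCount m j (h + 1) + exitUpCount m j (h - 1) else 0

/-- `w` is a path which, started at height `h`, stays nonnegative before its last step and ends at
height `-1`. -/
def IsExitPath {m : ℕ} (h : ℤ) (w : Fin m → ℤˣ) : Prop :=
  (∀ t < m, 0 ≤ h + psum w t) ∧ h + psum w m = -1

section Paths

lemma psum_at_zero {n : ℕ} (w : Fin n → ℤˣ) : psum w 0 = 0 := by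
  simp [psum]

lemma psum_cons {n : ℕ} (x : ℤˣ) (w : Fin n → ℤˣ) (t : ℕ) :
    psum (Fin.cons x w : Fin (n + 1) → ℤˣ) (t + 1) = x + psum w t := by
  simp [psum, Finset.sum_filter, Fin.sum_univ_succ]

lemma isExitPath_cons {m : ℕ} (h : ℤ) (x : ℤˣ) (w : Fin m → ℤˣ) :
    IsExitPath h (Fin.cons x w : Fin (m + 1) → ℤˣ) ↔ 0 ≤ h ∧ IsExitPath (h + x) w := by
  simp only [IsExitPath, psum_cons, ← add_assoc]
  constructor
  · rintro ⟨h1, h2⟩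
    refine ⟨by simpa [psum_at_zero] using h1 0 (by omega), fun t ht ↦ ?_, h2⟩
    simpa [psum_cons, add_assoc] using h1 (t + 1) (by omega)
  · rintro ⟨h0, h1, h2⟩
    refine ⟨fun t ht ↦ ?_, h2⟩
    cases t with
    | zero => simpa [psum_at_zero] using h0
    | succ t => simpa [psum_cons, add_assoc] using h1 t (by omega)

lemma card_fin_succ_units {m : ℕ} (P : (Fin (m + 1) → ℤˣ) → Prop) :
    Nat.card {w // P w} =
      Nat.card {w : Fin m → ℤˣ // P (Fin.cons 1 w)} +
        Nat.card {w : Fin m → ℤˣ // P (Fin.cons (-1) w)} := by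
  classical
  simp only [Nat.card_eq_fintype_card, Fintype.card_subtype, Finset.card_filter]
  rw [← (Fin.consEquiv fun _ : Fin (m + 1) ↦ ℤˣ).sum_comp, Fintype.sum_prod_type,
    UnitsInt.univ, Finset.sum_pair (by decide)]
  rfl

lemma card_isExitPath (m : ℕ) (h : ℤ) :
    Nat.card {w : Fin m → ℤˣ // IsExitPath h w} = exitCount m h := by
  induction m generalizing h with
  | zero =>
    by_cases hh : h = -1 <;> simp [IsExitPath, exitCount, psum_at_zero, hh]
  | succ m ih =>
    rw [card_fin_succ_units]
    by_cases hh : 0 ≤ h <;> simp [isExitPath_cons, exitCount, hh, ih, sub_eq_add_neg]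

lemma card_isExitPath_up (m j : ℕ) (h : ℤ) :
    Nat.card {w : Fin m → ℤˣ // IsExitPath h w ∧ ∀ i : Fin m, (i : ℕ) = j → w i = 1} =
      exitUpCount m j h := by
  induction m generalizing h j with
  | zero =>
    by_cases hh : h = -1 <;> simp [IsExitPath, exitUpCount, exitCount, psum_at_zero, hh]
  | succ m ih =>
    rw [card_fin_succ_units]
    cases j with
    | zero =>
      by_cases hh : 0 ≤ h <;>
        simp [isExitPath_cons, exitUpCount, hh, card_isExitPath]
    | succ j =>
      by_cases hh : 0 ≤ h <;>
        simp [isExitPath_cons, exitUpCount, hh, ih, sub_eq_add_neg, Fin.forall_fin_succ]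

lemma card_firstReturn {m : ℕ} (hm : 1 ≤ m) (Q : (Fin (m + 1) → ℤˣ) → Prop) :
    Nat.card {w : Fin (m + 1) → ℤˣ //
      ((∀ t : ℕ, 1 ≤ t → t ≤ m → 0 < psum w t) ∧ psum w (m + 1) = 0) ∧ Q w} =
      Nat.card {w : Fin m → ℤˣ // IsExitPath 0 w ∧ Q (Fin.cons 1 w)} := by
  rw [card_fin_succ_units]
  have hneg : ∀ w : Fin m → ℤˣ, ¬ (((∀ t : ℕ, 1 ≤ t → t ≤ m →
      0 < psum (Fin.cons (-1) w : Fin (m + 1) → ℤˣ) t) ∧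
      psum (Fin.cons (-1) w : Fin (m + 1) → ℤˣ) (m + 1) = 0) ∧ Q (Fin.cons (-1) w)) := by
    rintro w ⟨⟨h1, -⟩, -⟩
    have := h1 (0 + 1) le_rfl hm
    rw [psum_cons, psum_at_zero] at this
    simp at this
  have hpos : ∀ w : Fin m → ℤˣ, ((∀ t : ℕ, 1 ≤ t → t ≤ m →
      0 < psum (Fin.cons 1 w : Fin (m + 1) → ℤˣ) t) ∧
      psum (Fin.cons 1 w : Fin (m + 1) → ℤˣ) (m + 1) = 0) ↔ IsExitPath 0 w := by
    intro w
    simp only [psum_cons, IsExitPath, Units.val_one]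
    refine and_congr ⟨fun h t ht ↦ ?_, fun h t h1 ht ↦ ?_⟩ (by omega)
    · have := h (t + 1) (by omega) (by omega)
      rw [psum_cons, Units.val_one] at this
      omega
    · obtain ⟨t, rfl⟩ := Nat.exists_eq_add_of_le' h1
      have := h t (by omega)
      rw [psum_cons, Units.val_one]
      omega
  simp [hneg, hpos]

lemma Nup_one {l m : ℕ} (hm : 1 ≤ m) (hl : 2 * l = m + 1) : Nup l 1 = exitCount m 0 := by
  rw [Nup, hl, Nat.add_sub_cancel, card_firstReturn hm, ← card_isExitPath]
  simp

lemma Nup_add_two {l m : ℕ} (hm : 1 ≤ m) (hl : 2 * l = m + 1) (j : ℕ) :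
    Nup l (j + 2) = exitUpCount m j 0 := by
  rw [Nup, hl, Nat.add_sub_cancel, card_firstReturn hm, ← card_isExitPath_up]
  simp [Fin.forall_fin_succ]

end Paths

section Counting

lemma exitCount_eq_zero_of_le {m : ℕ} {h : ℤ} (hm : (m : ℤ) ≤ h) : exitCount m h = 0 := by
  induction m generalizing h with
  | zero => simp [exitCount]; omega
  | succ m ih =>
    push_cast at hm
    simp [exitCount, ih (h := h + 1) (by omega), ih (h := h - 1) (by omega)]

lemma exitCount_eq_zero_of_even {m : ℕ} {h : ℤ} (hm : Even (m + h)) : exitCount m h = 0 := by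
  induction m generalizing h with
  | zero =>
    rw [exitCount, if_neg]
    rintro rfl
    exact absurd hm (by decide)
  | succ m ih =>
    rw [exitCount, ih, ih, ite_self] <;> · push_cast at hm; grind

lemma exitCount_succ_neg (m : ℕ) {h : ℤ} (hh : h < 0) : exitCount (m + 1) h = 0 := by
  rw [exitCount, if_neg (by omega)]

/-- The ballot formula. -/
lemma exitCount_add_choose (m h k : ℕ) (hm : h + 2 * k = m) :
    exitCount (m + 1) h + m.choose (h + k + 1) = m.choose (h + k) := by
  induction m generalizing h k with
  | zero =>
    obtain rfl : h = 0 := by omega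
    obtain rfl : k = 0 := by omega
    simp [exitCount]
  | succ m ih =>
    have hup : exitCount (m + 1) ((h : ℤ) + 1) + m.choose (h + k + 1) = m.choose (h + k) := by
      cases k with
      | zero =>
        rw [exitCount_eq_zero_of_le (by omega), Nat.choose_eq_zero_of_lt (by omega),
          Nat.choose_eq_zero_of_lt (by omega)]
      | succ k =>
        have := ih (h + 1) k (by omega)
        rw [show h + 1 + k = h + (k + 1) by omega] at this
        exact_mod_cast this
    rw [exitCount, if_pos (by omega)]
    cases h with
    | zero =>
      obtain ⟨k, rfl⟩ : ∃ k', k = k' + 1 := ⟨k - 1, by omega⟩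
      have hsymm : m.choose k = m.choose (k + 1) := Nat.choose_symm_of_eq_add (by omega)
      rw [exitCount_succ_neg m (h := ((0 : ℕ) : ℤ) - 1) (by simp)]
      simp only [zero_add] at hup ⊢
      rw [Nat.choose_succ_succ' m k, Nat.choose_succ_succ' m (k + 1)]
      omega
    | succ h =>
      have := ih h k (by omega)
      rw [show ((h + 1 : ℕ) : ℤ) - 1 = h by push_cast; ring]
      rw [show h + 1 + k = h + k + 1 by omega] at hup ⊢
      rw [Nat.choose_succ_succ' m (h + k), Nat.choose_succ_succ' m (h + k + 1)]
      omega

lemma exitCount_odd_zero (n : ℕ) : exitCount (2 * n + 1) 0 = catalan n := by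
  have h1 := exitCount_add_choose (2 * n) 0 n (by omega)
  have h2 := Nat.choose_succ_right_eq (2 * n) n
  have h3 := succ_mul_catalan_eq_centralBinom n
  rw [Nat.centralBinom_eq_two_mul_choose] at h3
  rw [show 2 * n - n = n by omega] at h2
  simp only [zero_add, Nat.cast_zero] at h1
  apply Nat.eq_of_mul_eq_mul_left n.succ_pos
  rw [Nat.succ_eq_add_one, h3]
  nlinarith

lemma exitUpCount_eq_succ_add (j r : ℕ) (h : ℤ) :
    exitUpCount (j + r + 2) j h =
      exitUpCount (j + r + 2) (j + 1) h + exitCount r 0 * exitCount (j + 1) h := by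
  induction j generalizing h with
  | zero =>
    rcases lt_trichotomy h 0 with hh | rfl | hh
    · simp [exitUpCount, exitCount, hh.not_ge]
    · simp [exitUpCount, exitCount]
    · have h1 : 0 ≤ h := hh.le
      have h2 : 0 ≤ h + 1 := by omega
      have h3 : 1 ≤ h := hh
      have h4 : h + 1 ≠ -1 := by omega
      have h5 : h - 1 ≠ -1 := by omega
      simp [exitUpCount, exitCount, h1, h2, h3, h4, h5]
  | succ j ih =>
    rw [show j + 1 + r + 2 = j + r + 2 + 1 by omega, exitUpCount, exitUpCount, exitCount]
    split_ifs
    · rw [ih, ih]; ring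
    · simp

/-- Steps down at index `j` are counted by convolutions of Catalan numbers. -/
lemma exitUpCount_add_sum {n j : ℕ} (hj : j ≤ 2 * n + 2) :
    exitUpCount (2 * n + 3) j 0 +
      ∑ i ∈ Finset.range ((j + 1) / 2), catalan i * catalan (n - i) = catalan (n + 1) := by
  induction j with
  | zero =>
    have h1 := exitCount_odd_zero (n + 1)
    rw [show 2 * (n + 1) + 1 = 2 * n + 2 + 1 by ring, exitCount, if_pos le_rfl,
      exitCount_succ_neg (2 * n + 1) (h := 0 - 1) (by norm_num)] at h1
    simpa [exitUpCount] using h1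
  | succ j ih =>
    have hrec := exitUpCount_eq_succ_add j (2 * n + 1 - j) 0
    rw [show j + (2 * n + 1 - j) + 2 = 2 * n + 3 by omega] at hrec
    rw [← ih (by omega), hrec]
    obtain ⟨i, rfl | rfl⟩ := j.even_or_odd'
    · rw [show (2 * i + 1 + 1) / 2 = i + 1 by omega, show (2 * i + 1) / 2 = i by omega,
        Finset.sum_range_succ, show 2 * n + 1 - 2 * i = 2 * (n - i) + 1 by omega,
        exitCount_odd_zero, exitCount_odd_zero]
      ring
    · rw [show (2 * i + 1 + 1 + 1) / 2 = i + 1 by omega, show (2 * i + 1 + 1) / 2 = i + 1 by omega,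
        exitCount_eq_zero_of_even (m := 2 * i + 1 + 1) ⟨(i : ℤ) + 1, by push_cast; ring⟩]
      ring

lemma sum_range_sum_half (c : ℕ → ℤ) (q : ℕ) :
    ∑ j ∈ Finset.range q, ∑ i ∈ Finset.range ((j + 1) / 2), c i =
      ∑ i ∈ Finset.range (q / 2), c i * ((q : ℤ) - 1 - 2 * i) := by
  induction q with
  | zero => simp
  | succ q ih =>
    rw [Finset.sum_range_succ, ih]
    have hsplit : ∑ i ∈ Finset.range (q / 2), c i * ((q : ℤ) - 1 - 2 * i) =
        ∑ i ∈ Finset.range ((q + 1) / 2), c i * ((q : ℤ) - 1 - 2 * i) := by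
      obtain ⟨i, rfl | rfl⟩ := q.even_or_odd'
      · rw [show (2 * i + 1) / 2 = 2 * i / 2 by omega]
      · rw [show (2 * i + 1 + 1) / 2 = i + 1 by omega, show (2 * i + 1) / 2 = i by omega,
          Finset.sum_range_succ]
        push_cast
        ring
    rw [hsplit, ← Finset.sum_add_distrib]
    refine Finset.sum_congr rfl fun i _ ↦ ?_
    push_cast
    ring

end Counting

/-- Closed form for the total number of up-steps among the first `2l−Δ−1` positions over all
first-return paths (equation (174)/(80) in Appendix E): for integers `Δ ≥ 1` and `l ≥ 1`
with `2l ≥ Δ + 2`,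
`∑_{j=1}^{2l−Δ−1} N_up(l,j) = (2l−Δ−1)·C_{l−1} − ∑_{i=0}^{l−⌈Δ/2⌉−2} C_i·C_{l−2−i}·(2l−Δ−3−2i)`,
where the second sum (over `i ∈ Finset.range (l − ⌈Δ/2⌉ − 1)`, with `⌈Δ/2⌉ = (Δ+1)/2`)
is empty when `l − ⌈Δ/2⌉ − 2 < 0`. -/
theorem sum_Nup_closed_form (Δ l : ℕ) (hΔ : 1 ≤ Δ) (hl : 1 ≤ l) (h : Δ + 2 ≤ 2 * l) :
    (∑ j ∈ Finset.Icc 1 (2 * l - Δ - 1), (Nup l j : ℤ)) =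
      (2 * (l : ℤ) - (Δ : ℤ) - 1) * (catalan (l - 1) : ℤ) -
        ∑ i ∈ Finset.range (l - (Δ + 1) / 2 - 1),
          (catalan i : ℤ) * (catalan (l - 2 - i) : ℤ) *
            (2 * (l : ℤ) - (Δ : ℤ) - 3 - 2 * (i : ℤ)) := by
  obtain ⟨n, rfl⟩ : ∃ n, l = n + 2 := ⟨l - 2, by omega⟩
  obtain ⟨q, hq⟩ : ∃ q, 2 * (n + 2) - Δ - 1 = q + 1 := ⟨2 * (n + 2) - Δ - 2, by omega⟩
  have hqΔ : (q : ℤ) = 2 * n + 2 - Δ := by omega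
  have hlen : 2 * (n + 2) = 2 * n + 3 + 1 := by ring
  have hfirst : Nup (n + 2) 1 = catalan (n + 1) := by
    rw [Nup_one (by omega) hlen, ← exitCount_odd_zero]
    rfl
  have hterm : ∀ j ∈ Finset.range q, (Nup (n + 2) (j + 2) : ℤ) =
      catalan (n + 1) - ∑ i ∈ Finset.range ((j + 1) / 2), (catalan i * catalan (n - i) : ℤ) := by
    intro j hj
    rw [Finset.mem_range] at hj
    rw [Nup_add_two (by omega) hlen, ← exitUpCount_add_sum (n := n) (j := j) (by omega)]
    push_cast
    ring
  have hreindex : ∑ j ∈ Finset.Icc 1 (q + 1), (Nup (n + 2) j : ℤ) =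
      ∑ j ∈ Finset.range (q + 1), (Nup (n + 2) (j + 1) : ℤ) := by
    rw [Finset.range_eq_Ico, Finset.sum_Ico_add' (fun j ↦ (Nup (n + 2) j : ℤ))]
    rfl
  rw [hq, hreindex, Finset.sum_range_succ', Finset.sum_congr rfl hterm, Finset.sum_sub_distrib,
    sum_range_sum_half, zero_add, hfirst, show n + 2 - (Δ + 1) / 2 - 1 = q / 2 by omega]
  simp only [Finset.sum_const, Finset.card_range, nsmul_eq_mul, Nat.add_sub_cancel, hqΔ,
    show n + 2 - 1 = n + 1 by omega]
  push_cast
  ring_nf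
end

section
/- Convergence of the error-count series (the convergence Remark after Theorem 2 of the paper): for every real p with 1/2 < p < 1 and every integer Δ ≥ 1, the series ∑_{l=1}^∞ (p(1−p))^l · U(l, Δ) converges, where U(l, Δ) = ∑_{j=1}^{2l−Δ−1} N_up(l, j) when 2l ≥ Δ + 2 and U(l, Δ) = 0 otherwise. (Its value is the expected number of undecodable erasures per renewal cycle, E{N_e}, of a rate-1/2 systematic random linear streaming code with infinite memory over an i.i.d. packet erasure channel with delivery probability p and decoding delay Δ.) -/
/-- `U(l, Δ) = ∑_{j=1}^{2l−Δ−1} N_up(l,j)` when `2l ≥ Δ + 2`, and `0` otherwise. -/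
noncomputable def Ucount (l Δ : ℕ) : ℕ :=
  if Δ + 2 ≤ 2 * l then ∑ j ∈ Finset.Icc 1 (2 * l - Δ - 1), Nup l j else 0

theorem Nup_le_four_pow (l j : ℕ) : Nup l j ≤ 4 ^ l := by
  calc Nup l j ≤ Nat.card (Fin (2 * l) → ℤˣ) :=
        Nat.card_le_card_of_injective _ Subtype.val_injective
    _ = 4 ^ l := by
        rw [Nat.card_eq_fintype_card, Fintype.card_fun, Fintype.card_units_int, Fintype.card_fin,
          pow_mul]
        norm_num

theorem Ucount_le_mul_four_pow (l Δ : ℕ) : Ucount l Δ ≤ 2 * l * 4 ^ l := by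
  unfold Ucount
  split_ifs
  · calc ∑ j ∈ Finset.Icc 1 (2 * l - Δ - 1), Nup l j
        ≤ (Finset.Icc 1 (2 * l - Δ - 1)).card • 4 ^ l :=
          Finset.sum_le_card_nsmul _ _ _ fun j _ => Nup_le_four_pow l j
      _ ≤ 2 * l * 4 ^ l := by
          rw [Nat.card_Icc, smul_eq_mul]
          exact Nat.mul_le_mul_right _ (by omega)
  · exact Nat.zero_le _

/-- Convergence of the error-count series (the convergence Remark after Theorem 2): for every
real `p` with `1/2 < p < 1` and every integer `Δ ≥ 1`, the series
`∑_{l=1}^∞ (p(1−p))^l · U(l, Δ)` converges (here reindexed as `l+1`, `l : ℕ`). -/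
theorem error_count_series_summable (p : ℝ) (hp : 1 / 2 < p) (hp1 : p < 1)
    (Δ : ℕ) (hΔ : 1 ≤ Δ) :
    Summable (fun l : ℕ => (p * (1 - p)) ^ (l + 1) * (Ucount (l + 1) Δ : ℝ)) := by
  have hq : 0 ≤ p * (1 - p) := mul_nonneg (by linarith) (by linarith)
  have hr : p * (1 - p) * 4 < 1 := by nlinarith [mul_pos (sub_pos.2 hp) (sub_pos.2 hp)]
  generalize p * (1 - p) = q at hq hr ⊢
  have hn : ‖q * 4‖ < 1 := by
    rwa [Real.norm_of_nonneg (mul_nonneg hq (by norm_num))]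
  have hs : Summable fun l : ℕ => 2 * ((l : ℝ) ^ 1 * (q * 4) ^ l) :=
    (summable_pow_mul_geometric_of_norm_lt_one 1 hn).mul_left 2
  have hs' : Summable fun l : ℕ => 2 * (((l + 1 : ℕ) : ℝ) ^ 1 * (q * 4) ^ (l + 1)) :=
    (summable_nat_add_iff (f := fun l : ℕ => 2 * ((l : ℝ) ^ 1 * (q * 4) ^ l)) 1).2 hs
  refine hs'.of_nonneg_of_le
    (fun l => mul_nonneg (pow_nonneg hq _) (Nat.cast_nonneg _)) (fun l => ?_)
  have hU : (Ucount (l + 1) Δ : ℝ) ≤ 2 * ((l + 1 : ℕ) : ℝ) * 4 ^ (l + 1) := by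
    have h : (Ucount (l + 1) Δ : ℝ) ≤ ((2 * (l + 1) * 4 ^ (l + 1) : ℕ) : ℝ) :=
      Nat.cast_le.2 (Ucount_le_mul_four_pow (l + 1) Δ)
    simpa only [Nat.cast_mul, Nat.cast_pow, Nat.cast_ofNat] using h
  calc q ^ (l + 1) * (Ucount (l + 1) Δ : ℝ)
      ≤ q ^ (l + 1) * (2 * ((l + 1 : ℕ) : ℝ) * 4 ^ (l + 1)) :=
        mul_le_mul_of_nonneg_left hU (pow_nonneg hq _)
    _ = 2 * (((l + 1 : ℕ) : ℝ) ^ 1 * (q * 4) ^ (l + 1)) := by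
        rw [mul_pow q 4]
        ring
end
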